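/- For a connected finite graph G and an edge ℓ = {u,v} of G, the effective resistance between u and v (with all edge weights 1) equals t_ℓ(G)/t(G), where t_ℓ(G) is the number of spanning trees of G containing ℓ and t(G) is the total number of spanning trees of G. -/

import Mathlib

open Matrix

/-- Effective resistance, defined via the graph Laplacian (Dirichlet principle): the inverse
of the minimum Dirichlet energy `φᵀ L φ` over potentials with `φ s = 1`, `φ t = 0`. -/
noncomputable def effRes {V : Type*} [Fintype V] [DecidableEq V] (G : SimpleGraph V)
    [DecidableRel G.Adj] (s t : V) : ℝ :=
  (sInf {E : ℝ | ∃ φ : V → ℝ, φ s = 1 ∧ φ t = 0 ∧ E = φ ⬝ᵥ (G.lapMatrix ℝ *ᵥ φ)})⁻¹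

namespace SimpleGraph

variable {V : Type*}

/-- `F` is a forest with exactly two components, one containing `a` and the other `b`. -/
structure IsTwoForest (F : SimpleGraph V) (a b : V) : Prop where
  isAcyclic : F.IsAcyclic
  not_reachable : ¬F.Reachable a b
  reachable_or : ∀ x, F.Reachable a x ∨ F.Reachable b x

namespace IsTwoForest

variable {F : SimpleGraph V} {a b x y : V}

lemma symm (h : F.IsTwoForest a b) : F.IsTwoForest b a :=
  ⟨h.isAcyclic, fun hr ↦ h.not_reachable hr.symm, fun z ↦ (h.reachable_or z).symm⟩

lemma of_reachable (h : F.IsTwoForest a b) (hx : F.Reachable a x) (hy : F.Reachable b y) :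
    F.IsTwoForest x y where
  isAcyclic := h.isAcyclic
  not_reachable hr := h.not_reachable (hx.trans (hr.trans hy.symm))
  reachable_or z := (h.reachable_or z).imp hx.symm.trans hy.symm.trans

lemma reachable_right_iff (h : F.IsTwoForest a b) : F.Reachable b x ↔ ¬F.Reachable a x :=
  ⟨fun hb ha ↦ h.not_reachable (ha.trans hb.symm), (h.reachable_or x).resolve_left⟩

lemma ne (h : F.IsTwoForest a b) : a ≠ b := by
  rintro rfl
  exact h.not_reachable .rfl

lemma not_adj (h : F.IsTwoForest a b) : ¬F.Adj a b := fun hab ↦ h.not_reachable hab.reachable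

lemma sup_edge_adj (h : F.IsTwoForest a b) : (F ⊔ edge a b).Adj a b := by
  simp [edge_adj, h.ne]

lemma isTree_sup_edge (h : F.IsTwoForest a b) : (F ⊔ edge a b).IsTree where
  isAcyclic := h.isAcyclic.sup_edge_of_not_reachable h.not_reachable
  connected := by
    refine connected_iff_exists_forall_reachable _ |>.mpr ⟨a, fun x ↦ ?_⟩
    rcases h.reachable_or x with hx | hx
    · exact hx.mono le_sup_left
    · exact h.sup_edge_adj.reachable.trans (hx.mono le_sup_left)

lemma deleteEdges_sup_edge (h : F.IsTwoForest a b) :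
    (F ⊔ edge a b).deleteEdges {s(a, b)} = F := by
  rw [deleteEdges_sup, deleteEdges_edge (Set.mem_singleton _), sup_bot_eq, deleteEdges_eq_self,
    Set.disjoint_singleton_right]
  exact h.not_adj

end IsTwoForest

lemma deleteEdges_singleton_sup_edge {G : SimpleGraph V} {a b : V} (h : G.Adj a b) :
    G.deleteEdges {s(a, b)} ⊔ edge a b = G := by
  ext x y
  have := h.symm
  have := h.ne
  simp only [sup_adj, deleteEdges_adj, edge_adj, Set.mem_singleton_iff, Sym2.eq_iff]
  grind [G.ne_of_adj]

lemma Walk.IsPath.reachable_deleteEdges_snd {G : SimpleGraph V} {x v : V} {p : G.Walk x v}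
    (hp : p.IsPath) (hnil : ¬p.Nil) : (G.deleteEdges {s(x, p.snd)}).Reachable p.snd v := by
  by_contra hr
  have hnodup := hp.support_nodup
  rw [← Walk.cons_support_tail hnil, List.nodup_cons] at hnodup
  exact hnodup.1
    (p.tail.fst_mem_support_of_mem_edges (p.tail.mem_edges_of_not_reachable_deleteEdges hr))

lemma IsTree.isTwoForest_deleteEdges {T : SimpleGraph V} {a b : V} (hT : T.IsTree)
    (h : T.Adj a b) : (T.deleteEdges {s(a, b)}).IsTwoForest a b where
  isAcyclic := hT.isAcyclic.anti (deleteEdges_le _)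
  not_reachable := isBridge_iff.mp (isAcyclic_iff_forall_adj_isBridge.mp hT.isAcyclic h)
  reachable_or x := by
    obtain ⟨p, hp⟩ := hT.connected.exists_isPath a x
    by_cases hb : s(a, b) ∈ p.edges
    · right
      have hnil : ¬p.Nil := fun hn ↦ by simp [Walk.edges_eq_nil.mpr hn] at hb
      rw [hT.isAcyclic.eq_snd_of_adj_start hp h (p.snd_mem_support_of_mem_edges hb)]
      exact hp.reachable_deleteEdges_snd hnil
    · by_contra! hr
      exact hb (p.mem_edges_of_not_reachable_deleteEdges hr.1)

/-- In a tree, a vertex `x ≠ v` has a neighbour `y` such that deleting `xy` leaves `y` joined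
to `v`. -/
lemma IsTree.exists_adj_reachable_deleteEdges {T : SimpleGraph V} {x v : V} (hT : T.IsTree)
    (hxv : x ≠ v) : ∃ y, T.Adj x y ∧ (T.deleteEdges {s(x, y)}).Reachable y v := by
  obtain ⟨p, hp⟩ := hT.connected.exists_isPath x v
  have hnil : ¬p.Nil := fun h ↦ hxv h.eq
  exact ⟨p.snd, p.adj_snd hnil, hp.reachable_deleteEdges_snd hnil⟩

/-- In a tree, a vertex `x` has at most one neighbour `y` such that deleting `xy` leaves `y`
joined to `v`. -/
lemma IsTree.eq_of_reachable_deleteEdges {T : SimpleGraph V} {x y z v : V} (hT : T.IsTree)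
    (hy : T.Adj x y) (hz : T.Adj x z) (hyv : (T.deleteEdges {s(x, y)}).Reachable y v)
    (hzv : (T.deleteEdges {s(x, z)}).Reachable z v) : y = z := by
  obtain ⟨p, hp⟩ := hT.connected.exists_isPath x v
  have eq_snd : ∀ w, T.Adj x w → (T.deleteEdges {s(x, w)}).Reachable w v → w = p.snd :=
    fun w hw hwv ↦ hT.isAcyclic.eq_snd_of_adj_start hp hw <| p.snd_mem_support_of_mem_edges <|
      p.mem_edges_of_not_reachable_deleteEdges fun hr ↦
        (hT.isTwoForest_deleteEdges hw).not_reachable (hr.trans hwv.symm)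
  rw [eq_snd y hy hyv, eq_snd z hz hzv]

open scoped Classical in
/-- Pairs `(F, y)` of a two-component spanning forest and an edge `xy` joining the component
of `u`, which contains `x`, to that of `v` correspond to spanning trees in which `x` lies on the
path from `u` to `v` and `x ≠ v`. -/
lemma card_twoForest_edge_eq [Fintype V] [DecidableEq V] (G : SimpleGraph V) (u v x : V) :
    (Finset.univ.filter fun q : SimpleGraph V × V ↦ (q.1 ≤ G ∧ q.1.IsTwoForest u v) ∧
        G.Adj x q.2 ∧ q.1.Reachable u x ∧ q.1.Reachable v q.2).card =
      (Finset.univ.filter fun T : SimpleGraph V ↦ (T ≤ G ∧ T.IsTree) ∧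
        (∀ p : T.Walk u v, x ∈ p.support) ∧ x ≠ v).card := by
  refine Finset.card_bij (fun q _ ↦ q.1 ⊔ edge x q.2) ?_ ?_ ?_
  · rintro ⟨F, y⟩ hq
    simp only [Finset.mem_filter, Finset.mem_univ, true_and] at hq ⊢
    obtain ⟨⟨hFG, hF⟩, hxy, hux, hvy⟩ := hq
    have hF' := hF.of_reachable hux hvy
    refine ⟨⟨sup_le hFG ((edge_le_iff G).mpr (.inr hxy)), hF'.isTree_sup_edge⟩, fun p ↦ ?_, ?_⟩
    · refine Walk.fst_mem_support_of_mem_edges (u := y) p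
        (p.mem_edges_of_not_reachable_deleteEdges ?_)
      rw [hF'.deleteEdges_sup_edge]
      exact hF.not_reachable
    · rintro rfl
      exact hF.not_reachable hux
  · rintro ⟨F, y⟩ hq ⟨F', z⟩ hq' heq
    simp only [Finset.mem_filter, Finset.mem_univ, true_and] at hq hq' heq
    obtain ⟨⟨-, hF⟩, -, hux, hvy⟩ := hq
    obtain ⟨⟨-, hF'⟩, -, hux', hvz⟩ := hq'
    have h := hF.of_reachable hux hvy
    have h' := hF'.of_reachable hux' hvz
    have hyz : y = z := by
      refine h.isTree_sup_edge.eq_of_reachable_deleteEdges (v := v) h.sup_edge_adj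
        (heq ▸ h'.sup_edge_adj) ?_ ?_
      · rw [h.deleteEdges_sup_edge]
        exact hvy.symm
      · rw [heq, h'.deleteEdges_sup_edge]
        exact hvz.symm
    subst hyz
    rw [← h.deleteEdges_sup_edge, heq, h'.deleteEdges_sup_edge]
  · intro T hT
    simp only [Finset.mem_filter, Finset.mem_univ, true_and] at hT
    obtain ⟨⟨hTG, hT⟩, hp, hxv⟩ := hT
    obtain ⟨y, hxy, hyv⟩ := hT.exists_adj_reachable_deleteEdges hxv
    have hF := hT.isTwoForest_deleteEdges hxy
    have hxu : (T.deleteEdges {s(x, y)}).Reachable x u := by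
      refine (hF.reachable_or u).elim id fun hyu ↦ ?_
      obtain ⟨w⟩ := hyu.symm.trans hyv
      have hx := hp (w.mapLe (deleteEdges_le _))
      rw [Walk.support_mapLe_eq_support] at hx
      exact (w.takeUntil x hx).reachable.symm
    refine ⟨(T.deleteEdges {s(x, y)}, y), ?_, deleteEdges_singleton_sup_edge hxy⟩
    simp only [Finset.mem_filter, Finset.mem_univ, true_and]
    exact ⟨⟨(deleteEdges_le _).trans hTG, hF.of_reachable hxu hyv⟩, hTG hxy, hxu.symm, hyv.symm⟩

open scoped Classical in
/-- Adding the edge `uv` turns the two-component forests separating `u` from `v` into the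
spanning trees containing `uv`. -/
lemma card_twoForest_eq_card_isTree_adj [Fintype V] [DecidableEq V] (G : SimpleGraph V) {u v : V}
    (huv : G.Adj u v) :
    (Finset.univ.filter fun F : SimpleGraph V ↦ F ≤ G ∧ F.IsTwoForest u v).card =
      (Finset.univ.filter fun T : SimpleGraph V ↦ T ≤ G ∧ T.IsTree ∧ T.Adj u v).card := by
  refine Finset.card_bij' (fun F _ ↦ F ⊔ edge u v) (fun T _ ↦ T.deleteEdges {s(u, v)}) ?_ ?_ ?_ ?_
  · intro F hF
    simp only [Finset.mem_filter, Finset.mem_univ, true_and] at hF ⊢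
    exact ⟨sup_le hF.1 ((edge_le_iff G).mpr (.inr huv)), hF.2.isTree_sup_edge, hF.2.sup_edge_adj⟩
  · intro T hT
    simp only [Finset.mem_filter, Finset.mem_univ, true_and] at hT ⊢
    exact ⟨(deleteEdges_le _).trans hT.1, hT.2.1.isTwoForest_deleteEdges hT.2.2⟩
  · intro F hF
    exact (Finset.mem_filter.mp hF).2.2.deleteEdges_sup_edge
  · intro T hT
    exact deleteEdges_singleton_sup_edge (Finset.mem_filter.mp hT).2.2.2

open scoped Classical in
/-- The number of spanning two-component forests separating `u` from `v` with `x` on the side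
of `u`. -/
noncomputable def forestPotential [Fintype V] [DecidableEq V] (G : SimpleGraph V) (u v x : V) : ℝ :=
  ∑ F : SimpleGraph V with F ≤ G ∧ F.IsTwoForest u v, if F.Reachable u x then 1 else 0

open scoped Classical in
lemma sum_twoForest_crossing [Fintype V] [DecidableEq V] (G : SimpleGraph V)
    [DecidableRel G.Adj] (u v x : V) :
    ∑ y : V with G.Adj x y, ∑ F : SimpleGraph V with F ≤ G ∧ F.IsTwoForest u v,
        (if F.Reachable u x ∧ F.Reachable v y then (1 : ℝ) else 0) =
      ∑ T : SimpleGraph V with T ≤ G ∧ T.IsTree,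
        if (∀ p : T.Walk u v, x ∈ p.support) ∧ x ≠ v then 1 else 0 := by
  rw [Finset.sum_boole, Finset.filter_filter, ← card_twoForest_edge_eq, Finset.sum_comm,
    ← Finset.sum_product', Finset.sum_boole]
  congr 2
  ext ⟨F, y⟩
  simp [and_assoc]

/-- The Kirchhoff current law for the forest potential. -/
lemma lapMatrix_mulVec_forestPotential [Fintype V] [DecidableEq V] (G : SimpleGraph V)
    [DecidableRel G.Adj] {u v : V} (huv : u ≠ v) :
    G.lapMatrix ℝ *ᵥ G.forestPotential u v =
      (Nat.card {T : SimpleGraph V // T ≤ G ∧ T.IsTree} : ℝ) •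
        (Pi.single u 1 - Pi.single v 1 : V → ℝ) := by
  classical
  ext x
  have hN : G.neighborFinset x = Finset.univ.filter fun y ↦ G.Adj x y := by
    ext y
    simp
  have hsymm : ∀ T : SimpleGraph V,
      (∀ p : T.Walk v u, x ∈ p.support) ↔ ∀ p : T.Walk u v, x ∈ p.support := fun T ↦
    ⟨fun h p ↦ by simpa using h p.reverse, fun h p ↦ by simpa using h p.reverse⟩
  have hforest : ∀ F : SimpleGraph V, F.IsTwoForest v u ↔ F.IsTwoForest u v :=
    fun F ↦ ⟨.symm, .symm⟩
  have hvu := sum_twoForest_crossing G v u x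
  simp only [hsymm, hforest] at hvu
  calc (G.lapMatrix ℝ *ᵥ G.forestPotential u v) x
      = ∑ y : V with G.Adj x y, (G.forestPotential u v x - G.forestPotential u v y) := by
        rw [lapMatrix_mulVec_apply, Finset.sum_sub_distrib, Finset.sum_const, ← hN,
          card_neighborFinset_eq_degree, nsmul_eq_mul]
    _ = ∑ y : V with G.Adj x y, (∑ F : SimpleGraph V with F ≤ G ∧ F.IsTwoForest u v,
            (if F.Reachable u x ∧ F.Reachable v y then (1 : ℝ) else 0) -
          ∑ F : SimpleGraph V with F ≤ G ∧ F.IsTwoForest u v,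
            (if F.Reachable v x ∧ F.Reachable u y then (1 : ℝ) else 0)) := by
        refine Finset.sum_congr rfl fun y _ ↦ ?_
        rw [forestPotential, forestPotential, ← Finset.sum_sub_distrib, ← Finset.sum_sub_distrib]
        refine Finset.sum_congr rfl fun F hF ↦ ?_
        have hF := (Finset.mem_filter.mp hF).2.2
        by_cases hx : F.Reachable u x <;> by_cases hy : F.Reachable u y <;>
          simp [hF.reachable_right_iff, hx, hy]
    _ = ∑ T : SimpleGraph V with T ≤ G ∧ T.IsTree,
          ((Pi.single u 1 - Pi.single v 1 : V → ℝ) x) := by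
        rw [Finset.sum_sub_distrib, sum_twoForest_crossing, hvu, ← Finset.sum_sub_distrib]
        refine Finset.sum_congr rfl fun T _ ↦ ?_
        rcases eq_or_ne x u with rfl | hxu
        · simp [huv]
        · rcases eq_or_ne x v with rfl | hxv
          · simp [hxu]
          · simp [hxu, hxv]
    _ = _ := by
        rw [Finset.sum_const, nsmul_eq_mul, Nat.card_eq_fintype_card, Fintype.card_subtype]
        rfl

end SimpleGraph

/-- A potential `ψ` with unit drop between `s` and `t` whose current leaves only at `s` and `t`
minimises the Dirichlet energy, so the effective resistance is the inverse of its current. -/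
lemma effRes_eq_inv_of_lapMatrix_mulVec {V : Type*} [Fintype V] [DecidableEq V]
    (G : SimpleGraph V) [DecidableRel G.Adj] {s t : V} {ψ : V → ℝ} {c : ℝ} (hs : ψ s = 1)
    (ht : ψ t = 0)
    (hψ : G.lapMatrix ℝ *ᵥ ψ = c • (Pi.single s 1 - Pi.single t 1 : V → ℝ)) :
    effRes G s t = c⁻¹ := by
  have hcurrent : ∀ φ : V → ℝ, φ ⬝ᵥ (G.lapMatrix ℝ *ᵥ ψ) = c * (φ s - φ t) := fun φ ↦ by
    rw [hψ, dotProduct_smul, dotProduct_sub]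
    simp
  have hleast : IsLeast
      {E : ℝ | ∃ φ : V → ℝ, φ s = 1 ∧ φ t = 0 ∧ E = φ ⬝ᵥ (G.lapMatrix ℝ *ᵥ φ)} c := by
    refine ⟨⟨ψ, hs, ht, by simp [hcurrent, hs, ht]⟩, ?_⟩
    rintro _ ⟨φ, hφs, hφt, rfl⟩
    have hpos := (G.posSemidef_lapMatrix ℝ).dotProduct_mulVec_nonneg (φ - ψ)
    have hcomm : ψ ⬝ᵥ (G.lapMatrix ℝ *ᵥ φ) = φ ⬝ᵥ (G.lapMatrix ℝ *ᵥ ψ) := by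
      rw [dotProduct_mulVec, ← mulVec_transpose, (G.isSymm_lapMatrix ℝ).eq, dotProduct_comm]
    rw [star_trivial, mulVec_sub, dotProduct_sub, sub_dotProduct, sub_dotProduct, hcomm,
      hcurrent, hcurrent, hs, ht, hφs, hφt] at hpos
    linarith
  rw [effRes, hleast.csInf_eq]

/-- For a connected graph `G` and an edge `{u,v}` of `G`, the effective resistance between
`u` and `v` equals the number of spanning trees containing the edge divided by the total
number of spanning trees. -/
theorem effRes_eq_spanningTree_ratio {V : Type*} [Fintype V] [DecidableEq V]
    (G : SimpleGraph V) [DecidableRel G.Adj] (hG : G.Connected) (u v : V) (huv : G.Adj u v) :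
    effRes G u v =
      (Nat.card {H : SimpleGraph V // H ≤ G ∧ H.IsTree ∧ s(u, v) ∈ H.edgeSet} : ℝ) /
        (Nat.card {H : SimpleGraph V // H ≤ G ∧ H.IsTree} : ℝ) := by
  classical
  set m : ℝ := (Nat.card {H : SimpleGraph V // H ≤ G ∧ H.IsTree ∧ s(u, v) ∈ H.edgeSet} : ℝ)
    with hm
  have hu : G.forestPotential u v u = m := by
    rw [hm, Nat.card_eq_fintype_card, Fintype.card_subtype]
    simp [SimpleGraph.forestPotential, SimpleGraph.card_twoForest_eq_card_isTree_adj G huv]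
  have hv : G.forestPotential u v v = 0 :=
    Finset.sum_eq_zero fun F hF ↦ if_neg (Finset.mem_filter.mp hF).2.2.not_reachable
  have hm0 : m ≠ 0 := by
    obtain ⟨T, hle, hTG, hT⟩ := hG.exists_isTree_le_of_le_of_isAcyclic
      ((SimpleGraph.edge_le_iff G).mpr (.inr huv))
      (bot_sup_eq (SimpleGraph.edge u v) ▸ SimpleGraph.IsAcyclic.sup_edge_of_not_reachable
        (by simpa using huv.ne) SimpleGraph.isAcyclic_bot)
    have : Nonempty {H : SimpleGraph V // H ≤ G ∧ H.IsTree ∧ s(u, v) ∈ H.edgeSet} :=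
      ⟨T, hTG, hT, hle (by simp [SimpleGraph.edge_adj, huv.ne])⟩
    exact Nat.cast_ne_zero.mpr Nat.card_pos.ne'
  rw [effRes_eq_inv_of_lapMatrix_mulVec G (ψ := m⁻¹ • G.forestPotential u v)
    (c := m⁻¹ * Nat.card {H : SimpleGraph V // H ≤ G ∧ H.IsTree})
    (by simp [hu, hm0]) (by simp [hv])
    (by rw [mulVec_smul, G.lapMatrix_mulVec_forestPotential huv.ne, smul_smul])]
  rw [mul_inv, inv_inv, div_eq_mul_inv]
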